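/- Let q ≥ 8 be a power of 2 and G = SL₂(F_q). Then for every irreducible complex character χ of G of degree q (the Steinberg character) and every irreducible complex character ψ of G, the inner product ⟨χ², ψ⟩ equals 1. In particular c(χ²) = Irr(G). -/

import Mathlib

open scoped BigOperators

/-- The standard inner product of complex-valued class functions on a finite group:
`⟨α, β⟩ = |G|⁻¹ ∑ g, α g * conj (β g)`. -/
noncomputable def charInner {G : Type} [Group G] [Finite G] (α β : G → ℂ) : ℂ :=
  letI : Fintype G := Fintype.ofFinite G
  (Fintype.card G : ℂ)⁻¹ * ∑ g : G, α g * (starRingEnd ℂ) (β g)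

/-- `χ : G → ℂ` is an irreducible character if it is the character of some
irreducible (simple) finite-dimensional complex representation of `G`. -/
def IsIrreducibleCharacter (G : Type) [Group G] (χ : G → ℂ) : Prop :=
  ∃ V : FDRep ℂ G, CategoryTheory.Simple V ∧ χ = V.character

open CategoryTheory in
lemma FDRep.eq_bot_or_eq_top_of_simple {G : Type} [Group G] (V : FDRep ℂ G) [Simple V]
    (S : Submodule ℂ V) (hS : ∀ g, ∀ v ∈ S, V.ρ g v ∈ S) : S = ⊥ ∨ S = ⊤ := by
  rw [or_iff_not_imp_left]
  intro hbot
  let σ : Representation ℂ G S :=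
    Subrepresentation.toRepresentation (ρ := V.ρ) ⟨S, fun g v hv => hS g v hv⟩
  let f : FDRep.of σ ⟶ V := ⟨InducedCategory.homMk (ModuleCat.ofHom S.subtype), fun g ↦ by
    ext1; ext v; rfl⟩
  have hf : ∀ v : S, (f.hom.hom.hom) v = (v : V) := fun v => rfl
  have : Mono f := by
    apply ConcreteCategory.mono_of_injective
    exact Subtype.val_injective
  have hne : f ≠ 0 := by
    intro h
    apply hbot
    rw [eq_bot_iff]
    intro v hv
    have := hf ⟨v, hv⟩
    rw [h] at this
    exact this.symm
  have : IsIso f := (Simple.mono_isIso_iff_nonzero f).2 hne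
  rw [eq_top_iff]
  intro v _
  have h2 : (inv f ≫ f).hom.hom.hom v = v := by rw [IsIso.inv_hom_id]; rfl
  have h3 : (inv f ≫ f).hom.hom.hom v = f.hom.hom.hom ((inv f).hom.hom.hom v) := rfl
  rw [← h2, h3, hf]
  exact Subtype.property _

lemma exists_common_eigenvector {ι V : Type*} [AddCommGroup V] [Module ℂ V]
    [FiniteDimensional ℂ V] (A : ι → Module.End ℂ V) (hcomm : ∀ i j, Commute (A i) (A j))
    (W : Submodule ℂ V) (hW : W ≠ ⊥) (hA : ∀ i, ∀ w ∈ W, A i w ∈ W) :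
    ∃ w ∈ W, w ≠ 0 ∧ ∀ i, ∃ c : ℂ, A i w = c • w := by
  induction W using WellFoundedLT.induction with
  | ind W ih =>
  by_cases hex : ∃ i, ∃ c : ℂ, W ⊓ (A i).eigenspace c ≠ ⊥ ∧ W ⊓ (A i).eigenspace c ≠ W
  · obtain ⟨i, c, h0, h1⟩ := hex
    obtain ⟨w, hw, hw'⟩ := ih (W ⊓ (A i).eigenspace c) (lt_of_le_of_ne inf_le_left h1) h0 (by
      rintro j w ⟨hw, hw'⟩
      refine ⟨hA j w hw, ?_⟩
      simp only [SetLike.mem_coe, Module.End.mem_eigenspace_iff] at hw' ⊢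
      rw [← Module.End.mul_apply, hcomm i j, Module.End.mul_apply, hw', map_smul])
    exact ⟨w, hw.1, hw'⟩
  · push Not at hex
    obtain ⟨w, hw, hw0⟩ := W.exists_mem_ne_zero_of_ne_bot hW
    refine ⟨w, hw, hw0, fun i => ?_⟩
    have : Nontrivial W := Submodule.nontrivial_iff_ne_bot.2 hW
    obtain ⟨c, hc⟩ := Module.End.exists_eigenvalue ((A i).restrict (hA i))
    obtain ⟨x, hx⟩ := hc.exists_hasEigenvector
    have hx' := hx.apply_eq_smul
    have h2 := hex i c (by
      rw [Submodule.ne_bot_iff]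
      refine ⟨x, ⟨x.2, ?_⟩, by simpa using hx.2⟩
      rw [SetLike.mem_coe, Module.End.mem_eigenspace_iff]
      simpa using congrArg Subtype.val hx')
    refine ⟨c, ?_⟩
    rw [← h2] at hw
    exact Module.End.mem_eigenspace_iff.1 hw.2

open Matrix in
open scoped ComplexOrder in
lemma Representation.character_inv_eq_conj {G V : Type*} [Group G] [Finite G] [AddCommGroup V]
    [Module ℂ V] [FiniteDimensional ℂ V] (ρ : Representation ℂ G V) (g : G) :
    ρ.character g⁻¹ = starRingEnd ℂ (ρ.character g) := by
  have := Fintype.ofFinite G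
  classical
  let b := Module.finBasis ℂ V
  let M : G → Matrix _ _ ℂ := fun g => LinearMap.toMatrix b b (ρ g)
  have hM1 : M 1 = 1 := by simp [M]
  have hMmul : ∀ g h, M (g * h) = M g * M h := fun g h => by
    simp [M, LinearMap.toMatrix_mul]
  have htr : ∀ g, ρ.character g = (M g).trace := fun g =>
    LinearMap.trace_eq_matrix_trace ℂ b _
  let H := ∑ h, (M h)ᴴ * M h
  have hH : H.PosDef := by
    rw [show H = (M 1)ᴴ * M 1 + ∑ h ∈ Finset.univ.erase 1, (M h)ᴴ * M h by
      simp [H]]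
    refine Matrix.PosDef.add_posSemidef ?_ ?_
    · rw [hM1]; simpa using Matrix.PosDef.one
    · exact Matrix.posSemidef_sum _ fun h _ => Matrix.posSemidef_conjTranspose_mul_self _
  have hinv : (M g)ᴴ * H = H * M g⁻¹ := by
    simp only [H, Finset.mul_sum, Finset.sum_mul]
    refine Fintype.sum_equiv (Equiv.mulRight g) _ _ fun h => ?_
    simp only [Equiv.coe_mulRight, hMmul, Matrix.conjTranspose_mul, Matrix.mul_assoc]
    rw [← hMmul g g⁻¹, mul_inv_cancel, hM1, Matrix.mul_one]
  have hu := hH.isUnit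
  have hdet := (Matrix.isUnit_iff_isUnit_det _).1 hu
  have : (M g)ᴴ = H * M g⁻¹ * H⁻¹ := by
    rw [← hinv, Matrix.mul_assoc, Matrix.mul_nonsing_inv _ hdet, Matrix.mul_one]
  rw [htr, htr, starRingEnd_apply, ← Matrix.trace_conjTranspose, this, Matrix.trace_mul_comm,
    ← Matrix.mul_assoc, Matrix.nonsing_inv_mul _ hdet, Matrix.one_mul]

lemma eq_top_of_orbit {G V : Type*} [Group G] [AddCommGroup V] [Module ℂ V]
    (ρ : Representation ℂ G V)
    (hρ : ∀ S : Submodule ℂ V, (∀ g, ∀ v ∈ S, ρ g v ∈ S) → S = ⊥ ∨ S = ⊤) (w : V) (hw : w ≠ 0) :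
    Submodule.span ℂ (Set.range fun g => ρ g w) = ⊤ := by
  refine (hρ _ fun g v hv => ?_).resolve_left fun h => hw ?_
  · induction hv using Submodule.span_induction with
    | mem x hx =>
      obtain ⟨h, rfl⟩ := hx
      exact Submodule.subset_span ⟨g * h, by simp⟩
    | zero => simp
    | add x y _ _ hx hy => rw [map_add]; exact add_mem hx hy
    | smul c x _ hx => rw [map_smul]; exact Submodule.smul_mem _ c hx
  · have : w ∈ Submodule.span ℂ (Set.range fun g => ρ g w) :=
      Submodule.subset_span ⟨1, by simp⟩
    rw [h] at this
    simpa using this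

/-- An idempotent with one-dimensional range. -/
lemma trace_eq_one_of_isIdempotentElem {V : Type*} [AddCommGroup V] [Module ℂ V]
    [FiniteDimensional ℂ V] {P : Module.End ℂ V} (hP : IsIdempotentElem P) {w : V} (hw : w ≠ 0)
    (hPw : P w = w) (h : ∀ v, ∃ c : ℂ, P v = c • w) : LinearMap.trace ℂ V P = 1 := by
  rw [(LinearMap.IsIdempotentElem.isProj_range P hP).trace, show LinearMap.range P = Submodule.span ℂ {w} from ?_,
    finrank_span_singleton hw, Nat.cast_one]
  apply le_antisymm
  · rintro _ ⟨v, rfl⟩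
    obtain ⟨c, hc⟩ := h v
    exact Submodule.mem_span_singleton.2 ⟨c, hc.symm⟩
  · rw [Submodule.span_singleton_le_iff_mem]
    exact ⟨w, hPw⟩

lemma exists_of_trace_eq_one {V : Type*} [AddCommGroup V] [Module ℂ V]
    [FiniteDimensional ℂ V] {P : Module.End ℂ V} (hP : IsIdempotentElem P)
    (h : LinearMap.trace ℂ V P = 1) : ∃ w, w ≠ 0 ∧ P w = w ∧ ∀ v, ∃ c : ℂ, P v = c • w := by
  rw [(LinearMap.IsIdempotentElem.isProj_range P hP).trace, Nat.cast_eq_one] at h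
  obtain ⟨⟨w, hw⟩, hw0, hw'⟩ := finrank_eq_one_iff'.1 h
  refine ⟨w, by simpa using hw0, (LinearMap.IsIdempotentElem.isProj_range P hP).map_id w hw, fun v => ?_⟩
  obtain ⟨c, hc⟩ := hw' ⟨P v, v, rfl⟩
  exact ⟨c, by simpa using (congrArg Subtype.val hc).symm⟩

lemma eq_one_of_trace_eq_finrank {V : Type*} [AddCommGroup V] [Module ℂ V]
    [FiniteDimensional ℂ V] {P : Module.End ℂ V} (hP : IsIdempotentElem P)
    (h : LinearMap.trace ℂ V P = Module.finrank ℂ V) : P = 1 := by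
  have h1 : IsIdempotentElem (1 - P) := hP.one_sub
  have := LinearMap.IsIdempotentElem.eq_zero_of_trace_eq_zero h1 (by
    rw [map_sub, h, LinearMap.trace_one, sub_self])
  exact (sub_eq_zero.1 this).symm

namespace SL2

open Matrix Matrix.SpecialLinearGroup

variable {F : Type} [Field F]

/-- The upper unitriangular element of `SL₂(F)` with upper right entry `x`. -/
def unip (x : F) : SpecialLinearGroup (Fin 2) F := ⟨!![1, x; 0, 1], by simp [det_fin_two_of]⟩

/-- The diagonal element `diag(a, a⁻¹)` of `SL₂(F)`. -/
def diag (a : Fˣ) : SpecialLinearGroup (Fin 2) F :=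
  ⟨!![(a : F), 0; 0, ((a⁻¹ : Fˣ) : F)], by simp [det_fin_two_of]⟩

/-- The Weyl element of `SL₂(F)`. -/
def weyl : SpecialLinearGroup (Fin 2) F := ⟨!![0, -1; 1, 0], by simp [det_fin_two_of]⟩

lemma ext_entries {g h : SpecialLinearGroup (Fin 2) F} (h00 : g 0 0 = h 0 0) (h01 : g 0 1 = h 0 1)
    (h10 : g 1 0 = h 1 0) (h11 : g 1 1 = h 1 1) : g = h := by
  ext i j
  fin_cases i <;> fin_cases j <;> assumption

lemma det_entries (g : SpecialLinearGroup (Fin 2) F) : g 0 0 * g 1 1 - g 0 1 * g 1 0 = 1 := by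
  rw [← det_fin_two]; exact g.2

@[simp] lemma unip_00 (x : F) : unip x 0 0 = 1 := rfl
@[simp] lemma unip_01 (x : F) : unip x 0 1 = x := rfl
@[simp] lemma unip_10 (x : F) : unip x 1 0 = 0 := rfl
@[simp] lemma unip_11 (x : F) : unip x 1 1 = 1 := rfl
@[simp] lemma diag_00 (a : Fˣ) : diag a 0 0 = a := rfl
@[simp] lemma diag_01 (a : Fˣ) : diag a 0 1 = 0 := rfl
@[simp] lemma diag_10 (a : Fˣ) : diag a 1 0 = 0 := rfl
@[simp] lemma diag_11 (a : Fˣ) : diag a 1 1 = (a⁻¹ : Fˣ) := rfl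
@[simp] lemma weyl_00 : (weyl : SpecialLinearGroup (Fin 2) F) 0 0 = 0 := rfl
@[simp] lemma weyl_01 : (weyl : SpecialLinearGroup (Fin 2) F) 0 1 = -1 := rfl
@[simp] lemma weyl_10 : (weyl : SpecialLinearGroup (Fin 2) F) 1 0 = 1 := rfl
@[simp] lemma weyl_11 : (weyl : SpecialLinearGroup (Fin 2) F) 1 1 = 0 := rfl

lemma mul_entry (g h : SpecialLinearGroup (Fin 2) F) (i j : Fin 2) :
    (g * h) i j = g i 0 * h 0 j + g i 1 * h 1 j := by
  rw [coe_mul, mul_apply, Fin.sum_univ_two]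

@[simp] lemma inv_00 (g : SpecialLinearGroup (Fin 2) F) : g⁻¹ 0 0 = g 1 1 := by
  rw [SL2_inv_expl]; rfl
@[simp] lemma inv_01 (g : SpecialLinearGroup (Fin 2) F) : g⁻¹ 0 1 = -g 0 1 := by
  rw [SL2_inv_expl]; rfl
@[simp] lemma inv_10 (g : SpecialLinearGroup (Fin 2) F) : g⁻¹ 1 0 = -g 1 0 := by
  rw [SL2_inv_expl]; rfl
@[simp] lemma inv_11 (g : SpecialLinearGroup (Fin 2) F) : g⁻¹ 1 1 = g 0 0 := by
  rw [SL2_inv_expl]; rfl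

@[simp] lemma unip_zero : unip (0 : F) = 1 := by
  apply ext_entries <;> simp

lemma unip_mul (x y : F) : unip x * unip y = unip (x + y) := by
  apply ext_entries <;> simp [mul_entry, add_comm]

lemma diag_mul (a b : Fˣ) : diag a * diag b = diag (a * b) := by
  apply ext_entries <;> simp [mul_entry, mul_comm]

@[simp] lemma diag_one : diag (1 : Fˣ) = 1 := by
  apply ext_entries <;> simp

lemma diag_mul_unip (a : Fˣ) (x : F) : diag a * unip x = unip (a ^ 2 * x) * diag a := by
  apply ext_entries <;> simp [mul_entry]
  field_simp

lemma diag_mul_weyl (a : Fˣ) : diag a * weyl = weyl * diag a⁻¹ := by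
  apply ext_entries <;> simp [mul_entry]

lemma eq_diag_mul_unip (g : SpecialLinearGroup (Fin 2) F) (h : g 1 0 = 0) :
    ∃ (a : Fˣ) (x : F), g = diag a * unip x := by
  have hd := det_entries g
  simp only [h, mul_zero, sub_zero] at hd
  have h0 : g 0 0 ≠ 0 := left_ne_zero_of_mul_eq_one hd
  refine ⟨Units.mk0 _ h0, (g 0 0)⁻¹ * g 0 1, ?_⟩
  apply ext_entries <;> simp [mul_entry, h, h0]
  exact eq_inv_of_mul_eq_one_right hd

/-- The big Bruhat cell. -/
lemma eq_bruhat (g : SpecialLinearGroup (Fin 2) F) (h : g 1 0 ≠ 0) :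
    g = unip (g 0 0 / g 1 0) * (weyl * diag (Units.mk0 _ h)) * unip (g 1 1 / g 1 0) := by
  have hd := det_entries g
  apply ext_entries <;> simp [mul_entry, h]
  · field_simp
    linear_combination -hd
  · field_simp

/-- The anti-involution of `SL₂(F)` exchanging the two diagonal entries. -/
def swap (g : SpecialLinearGroup (Fin 2) F) : SpecialLinearGroup (Fin 2) F :=
  ⟨!![g 1 1, g 0 1; g 1 0, g 0 0], by rw [det_fin_two_of]; linear_combination det_entries g⟩

@[simp] lemma swap_00 (g : SpecialLinearGroup (Fin 2) F) : swap g 0 0 = g 1 1 := rfl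
@[simp] lemma swap_01 (g : SpecialLinearGroup (Fin 2) F) : swap g 0 1 = g 0 1 := rfl
@[simp] lemma swap_10 (g : SpecialLinearGroup (Fin 2) F) : swap g 1 0 = g 1 0 := rfl
@[simp] lemma swap_11 (g : SpecialLinearGroup (Fin 2) F) : swap g 1 1 = g 0 0 := rfl

lemma swap_mul (g h : SpecialLinearGroup (Fin 2) F) : swap (g * h) = swap h * swap g := by
  apply ext_entries <;> simp [mul_entry] <;> ring

@[simp] lemma swap_unip (x : F) : swap (unip x) = unip x := by
  apply ext_entries <;> simp

lemma swap_eq_conj (g : SpecialLinearGroup (Fin 2) F) (h : g 1 0 ≠ 0) :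
    ∃ x : F, swap g = unip x * g * unip (-x) := by
  refine ⟨(g 1 1 - g 0 0) / g 1 0, ?_⟩
  apply ext_entries <;> simp [mul_entry] <;> field_simp <;> ring

lemma rho_eq_one_of_unip {V : Type*} [AddCommGroup V] [Module ℂ V]
    (ρ : Representation ℂ (SpecialLinearGroup (Fin 2) F) V) (h : ∀ x, ρ (unip x) = 1)
    (g : SpecialLinearGroup (Fin 2) F) : ρ g = 1 := by
  have hlow : ∀ x, ρ (weyl * unip x * weyl⁻¹) = 1 := fun x => by
    rw [map_mul, map_mul, h, mul_one, ← map_mul, mul_inv_cancel, map_one]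
  have key : ∀ g : SpecialLinearGroup (Fin 2) F, g 1 0 ≠ 0 → ρ g = 1 := by
    intro g hg
    have hd := det_entries g
    have : g = unip ((g 0 0 - 1) / g 1 0) * (weyl * unip (-g 1 0) * weyl⁻¹) *
        unip ((g 1 1 - 1) / g 1 0) := by
      apply ext_entries <;> simp [mul_entry]
      · field_simp; ring
      · field_simp; linear_combination -hd
      · field_simp; ring
    rw [this, map_mul, map_mul, h, h, hlow, one_mul, one_mul]
  by_cases hg : g 1 0 = 0
  · have hw := key weyl (by simp)
    have hd := det_entries g
    have h1 := key (weyl * g) (by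
      simp only [mul_entry, weyl_10, weyl_11, one_mul, zero_mul, add_zero]
      intro h0
      simp [h0, hg] at hd)
    rwa [map_mul, hw, one_mul] at h1
  · exact key g hg

section Rep

variable [Fintype F] {V : Type*} [AddCommGroup V] [Module ℂ V]
  (ρ : Representation ℂ (SpecialLinearGroup (Fin 2) F) V)

lemma card_ne_zero : (Fintype.card F : ℂ) ≠ 0 := Nat.cast_ne_zero.2 Fintype.card_ne_zero

/-- The projection onto the `θ`-eigenspace of the unipotent subgroup. -/
noncomputable def unipProj (θ : AddChar F ℂ) : Module.End ℂ V :=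
  (Fintype.card F : ℂ)⁻¹ • ∑ x : F, θ (-x) • ρ (unip x)

lemma rho_unip_mul_unipProj (θ : AddChar F ℂ) (y : F) :
    ρ (unip y) * unipProj ρ θ = θ y • unipProj ρ θ := by
  rw [unipProj, mul_smul_comm, smul_comm (θ y), Finset.mul_sum, Finset.smul_sum (r := θ y)]
  congr 1
  refine Fintype.sum_equiv (Equiv.addLeft y) _ (fun x => θ y • θ (-x) • ρ (unip x)) fun x => ?_
  rw [mul_smul_comm, ← map_mul, unip_mul, smul_smul, ← AddChar.map_add_eq_mul]
  simp

lemma unipProj_mul_rho_unip (θ : AddChar F ℂ) (y : F) :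
    unipProj ρ θ * ρ (unip y) = θ y • unipProj ρ θ := by
  rw [unipProj, smul_mul_assoc, smul_comm (θ y), Finset.sum_mul, Finset.smul_sum (r := θ y)]
  congr 1
  refine Fintype.sum_equiv (Equiv.addLeft y) _ (fun x => θ y • θ (-x) • ρ (unip x)) fun x => ?_
  rw [smul_mul_assoc, ← map_mul, unip_mul, smul_smul, ← AddChar.map_add_eq_mul]
  simp [add_comm]

lemma mul_unipProj_mul (θ : AddChar F ℂ) (A B : Module.End ℂ V) :
    A * unipProj ρ θ * B =
      (Fintype.card F : ℂ)⁻¹ • ∑ x : F, θ (-x) • (A * ρ (unip x) * B) := by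
  simp [unipProj, Finset.mul_sum, Finset.sum_mul]

lemma isIdempotentElem_unipProj (θ : AddChar F ℂ) : IsIdempotentElem (unipProj ρ θ) := by
  have h := mul_unipProj_mul ρ θ 1 (unipProj ρ θ)
  simp only [one_mul, rho_unip_mul_unipProj, smul_smul, ← AddChar.map_add_eq_mul] at h
  rw [IsIdempotentElem, h]
  simp [← Nat.cast_smul_eq_nsmul ℂ, smul_smul]

lemma hecke_of_lower_left_eq_zero [CharP F 2] {θ : AddChar F ℂ} (hθ : θ ≠ 1)
    (g : SpecialLinearGroup (Fin 2) F) (h : g 1 0 = 0) (hne : g 0 0 ≠ g 1 1) :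
    unipProj ρ θ * ρ g * unipProj ρ θ = 0 := by
  have hd := det_entries g
  simp only [h, mul_zero, sub_zero] at hd
  have h1 : g 0 0 ^ 2 - 1 ≠ 0 := by
    intro h0
    have : (g 0 0 - 1) ^ 2 = 0 := by rw [CharTwo.sub_eq_add, CharTwo.add_sq, ← CharTwo.sub_eq_add]; simpa using h0
    have h00 : g 0 0 = 1 := sub_eq_zero.1 (pow_eq_zero_iff two_ne_zero |>.1 this)
    rw [h00, one_mul] at hd
    exact hne (h00.trans hd.symm)
  obtain ⟨y, hy⟩ := AddChar.ne_one_iff.1 hθ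
  set x := y / (g 0 0 ^ 2 - 1) with hx
  have hconj : g * unip x = unip (g 0 0 ^ 2 * x) * g := by
    apply ext_entries <;> simp [mul_entry, h]
    linear_combination (- g 0 0 * x) * hd
  have e1 : unipProj ρ θ * ρ (g * unip x) * unipProj ρ θ =
      θ x • (unipProj ρ θ * ρ g * unipProj ρ θ) := by
    rw [map_mul, mul_assoc, mul_assoc, rho_unip_mul_unipProj, mul_smul_comm, mul_smul_comm,
      mul_assoc]
  have e2 : unipProj ρ θ * ρ (g * unip x) * unipProj ρ θ =
      θ (g 0 0 ^ 2 * x) • (unipProj ρ θ * ρ g * unipProj ρ θ) := by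
    rw [hconj, map_mul, ← mul_assoc, unipProj_mul_rho_unip, smul_mul_assoc, smul_mul_assoc]
  rw [e1, ← sub_eq_zero, ← sub_smul, smul_eq_zero] at e2
  refine e2.resolve_left fun h2 => hy ?_
  have : g 0 0 ^ 2 * x = x + y := by rw [hx]; field_simp; ring
  rw [this, AddChar.map_add_eq_mul] at h2
  have hx0 : θ x ≠ 0 := fun h0 => by
    have := θ.map_add_eq_mul x (-x)
    simp [h0] at this
  exact mul_left_cancel₀ hx0 (by linear_combination -h2)

lemma hecke_swap [CharP F 2] {θ : AddChar F ℂ} (hθ : θ ≠ 1)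
    (g : SpecialLinearGroup (Fin 2) F) :
    unipProj ρ θ * ρ (swap g) * unipProj ρ θ = unipProj ρ θ * ρ g * unipProj ρ θ := by
  by_cases h : g 1 0 = 0
  · by_cases hne : g 0 0 = g 1 1
    · congr 3
      apply ext_entries <;> simp [hne]
    · rw [hecke_of_lower_left_eq_zero ρ hθ g h hne,
        hecke_of_lower_left_eq_zero ρ hθ (swap g) (by simpa using h) (by simpa using Ne.symm hne)]
  · obtain ⟨x, hx⟩ := swap_eq_conj g h
    rw [hx, map_mul, map_mul, ← mul_assoc, ← mul_assoc, unipProj_mul_rho_unip, mul_assoc,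
      rho_unip_mul_unipProj, smul_mul_assoc, smul_mul_assoc, mul_smul_comm, smul_smul,
      ← AddChar.map_add_eq_mul]
    simp

/-- The Hecke algebra of a nontrivial character of the unipotent subgroup is commutative. -/
lemma hecke_commute [CharP F 2] {θ : AddChar F ℂ} (hθ : θ ≠ 1)
    (g h : SpecialLinearGroup (Fin 2) F) :
    Commute (unipProj ρ θ * ρ g * unipProj ρ θ) (unipProj ρ θ * ρ h * unipProj ρ θ) := by
  have key : ∀ g h, (unipProj ρ θ * ρ g * unipProj ρ θ) * (unipProj ρ θ * ρ h * unipProj ρ θ) =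
      (Fintype.card F : ℂ)⁻¹ • ∑ x : F,
        θ (-x) • (unipProj ρ θ * ρ (g * unip x * h) * unipProj ρ θ) := by
    intro g h
    have := mul_unipProj_mul ρ θ (unipProj ρ θ * ρ g) (ρ h * unipProj ρ θ)
    simp only [map_mul]
    calc _ = unipProj ρ θ * ρ g * (unipProj ρ θ * unipProj ρ θ) * (ρ h * unipProj ρ θ) := by
          simp only [mul_assoc]
      _ = _ := by
          rw [(isIdempotentElem_unipProj ρ θ).eq, this]
          simp only [mul_assoc]
  calc _ = (Fintype.card F : ℂ)⁻¹ • ∑ x : F,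
        θ (-x) • (unipProj ρ θ * ρ (swap h * unip x * swap g) * unipProj ρ θ) := by
        rw [key]
        congr 1
        refine Finset.sum_congr rfl fun x _ => ?_
        rw [← hecke_swap ρ hθ, swap_mul, swap_mul, swap_unip, ← mul_assoc (swap h)]
    _ = _ := by rw [← key, hecke_swap ρ hθ, hecke_swap ρ hθ]

lemma character_unip [CharP F 2] {x : F} (hx : x ≠ 0) :
    ρ.character (unip x) = ρ.character (unip 1) := by
  obtain ⟨a, ha⟩ := FiniteField.isSquare_of_char_two (ringChar.eq F 2) x
  have ha0 : a ≠ 0 := by rintro rfl; simp [ha] at hx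
  have h := diag_mul_unip (Units.mk0 a ha0) 1
  rw [← mul_inv_eq_iff_eq_mul] at h
  rw [← Representation.char_conj ρ (unip 1) (diag (Units.mk0 a ha0)), h, ha]
  simp [sq]

lemma trace_unipProj [CharP F 2] (θ : AddChar F ℂ) :
    LinearMap.trace ℂ V (unipProj ρ θ) = (Fintype.card F : ℂ)⁻¹ *
      (ρ.character 1 + (∑ x, θ x - 1) * ρ.character (unip 1)) := by
  classical
  rw [unipProj, map_smul, smul_eq_mul, map_sum]
  congr 1
  rw [← Finset.add_sum_erase _ _ (Finset.mem_univ (0 : F)),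
    ← Finset.add_sum_erase _ θ (Finset.mem_univ (0 : F))]
  simp only [map_smul, smul_eq_mul, neg_zero, AddChar.map_zero_eq_one, unip_zero, one_mul,
    add_sub_cancel_left, Finset.sum_mul]
  congr 1
  refine Finset.sum_congr rfl fun x hx => ?_
  rw [← character_unip ρ (Finset.ne_of_mem_erase hx), CharTwo.neg_eq]
  rfl

lemma trace_unipProj_one [CharP F 2] :
    LinearMap.trace ℂ V (unipProj ρ 1) = (Fintype.card F : ℂ)⁻¹ *
      (ρ.character 1 + (Fintype.card F - 1) * ρ.character (unip 1)) := by
  simp [trace_unipProj]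

lemma unipProj_one_mul_diag (a : Fˣ) :
    unipProj ρ 1 * ρ (diag a) = ρ (diag a) * unipProj ρ 1 := by
  simp only [unipProj, smul_mul_assoc, mul_smul_comm, Finset.sum_mul, Finset.mul_sum,
    AddChar.one_apply, one_smul]
  congr 1
  symm
  refine Fintype.sum_equiv (Equiv.mulLeft₀ ((a : F) ^ 2) (by simp)) _ _ fun x => ?_
  rw [← map_mul, ← map_mul, diag_mul_unip]
  rfl

/-- If the unipotent fixed vectors form a line, the torus acts trivially on it. -/
lemma diag_apply_of_unipProj [CharP F 2] {v : V} (hv0 : v ≠ 0) (hv : unipProj ρ 1 v = v)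
    (hline : ∀ x, ∃ c : ℂ, unipProj ρ 1 x = c • v) (a : Fˣ) : ρ (diag a) v = v := by
  have hu : ∀ x, ρ (unip x) v = v := fun x => by
    have := congrArg (· v) (rho_unip_mul_unipProj ρ 1 x)
    simpa [hv] using this
  have hT : ∀ a : Fˣ, ∃ c : ℂ, ρ (diag a) v = c • v := fun a => by
    obtain ⟨c, hc⟩ := hline (ρ (diag a) v)
    refine ⟨c, hc ▸ ?_⟩
    have := congrArg (· v) (unipProj_one_mul_diag ρ a)
    simpa [hv] using this.symm
  obtain ⟨γ, hγ⟩ := hline (ρ weyl v)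
  have hγ0 : γ ≠ 0 := by
    rintro rfl
    rw [zero_smul] at hγ
    have hbig : ∀ g : SpecialLinearGroup (Fin 2) F, g 1 0 ≠ 0 → unipProj ρ 1 (ρ g v) = 0 := by
      intro g hg
      obtain ⟨c, hc⟩ := hT (Units.mk0 _ hg)
      rw [eq_bruhat g hg]
      simp only [map_mul, Module.End.mul_apply, hu, hc, map_smul]
      rw [← Module.End.mul_apply, unipProj_mul_rho_unip]
      simp [hγ]
    have hz : unipProj ρ 1 (ρ weyl (unipProj ρ 1 (ρ weyl v))) = (Fintype.card F : ℂ)⁻¹ • v := by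
      have h2 := congrArg (· v) (mul_unipProj_mul ρ 1 (unipProj ρ 1 * ρ weyl) (ρ weyl))
      simp only [Module.End.mul_apply, LinearMap.smul_apply, LinearMap.sum_apply,
        AddChar.one_apply, one_smul] at h2
      rw [h2, Finset.sum_eq_single 0]
      · have hww : (weyl * weyl : SpecialLinearGroup (Fin 2) F) = 1 := by
          apply ext_entries <;> simp [mul_entry, CharTwo.neg_eq]
        rw [unip_zero, map_one, Module.End.one_apply, ← Module.End.mul_apply (ρ weyl), ← map_mul,
          hww, map_one, Module.End.one_apply, hv]
      · intro x _ hx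
        have := hbig (weyl * unip x * weyl) (by simpa [mul_entry] using hx)
        rwa [map_mul, map_mul] at this
      · simp
    rw [hγ, map_zero, map_zero, eq_comm, smul_eq_zero] at hz
    exact hv0 (hz.resolve_left (inv_ne_zero card_ne_zero))
  obtain ⟨b, hb⟩ := FiniteField.isSquare_of_char_two (ringChar.eq F 2) (a : F)
  have hb0 : b ≠ 0 := by rintro rfl; simp at hb
  set β := Units.mk0 b hb0
  have hab : a = β * β := Units.ext hb
  obtain ⟨c, hc⟩ := hT β
  obtain ⟨d, hd⟩ := hT β⁻¹
  have hcd : c = d := by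
    have h1 : ρ (diag β) (unipProj ρ 1 (ρ weyl v)) = unipProj ρ 1 (ρ weyl (ρ (diag β⁻¹) v)) := by
      simp only [← Module.End.mul_apply]
      rw [← mul_assoc, ← unipProj_one_mul_diag, mul_assoc, ← map_mul, diag_mul_weyl, map_mul,
        ← mul_assoc]
    rw [hγ, hd, map_smul, hc, map_smul, map_smul, hγ, smul_smul, smul_smul] at h1
    have := smul_left_injective ℂ hv0 h1
    rw [mul_comm] at this
    exact mul_right_cancel₀ hγ0 this
  rw [hab, ← diag_mul, map_mul, Module.End.mul_apply, hc, hcd, ← hd,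
    ← Module.End.mul_apply, ← map_mul, diag_mul, mul_inv_cancel, diag_one, map_one,
    Module.End.one_apply]

variable [FiniteDimensional ℂ V]

/-- Multiplicity one for Whittaker models. -/
lemma trace_unipProj_eq_one [CharP F 2]
    (hρ : ∀ S : Submodule ℂ V, (∀ g, ∀ v ∈ S, ρ g v ∈ S) → S = ⊥ ∨ S = ⊤)
    {θ : AddChar F ℂ} (hθ : θ ≠ 1) (h0 : unipProj ρ θ ≠ 0) :
    LinearMap.trace ℂ V (unipProj ρ θ) = 1 := by
  have hid := isIdempotentElem_unipProj ρ θ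
  obtain ⟨w, hw, hw0, hc⟩ := exists_common_eigenvector
    (fun g => unipProj ρ θ * ρ g * unipProj ρ θ) (hecke_commute ρ hθ)
    (LinearMap.range (unipProj ρ θ)) (by rwa [Ne, LinearMap.range_eq_bot])
    (fun g v _ => ⟨_, rfl⟩)
  have hPw : unipProj ρ θ w = w := by
    obtain ⟨v, rfl⟩ := hw
    rw [← Module.End.mul_apply, hid.eq]
  refine trace_eq_one_of_isIdempotentElem hid hw0 hPw fun v => ?_
  have hv : v ∈ Submodule.span ℂ (Set.range fun g => ρ g w) := by
    rw [eq_top_of_orbit ρ hρ w hw0]; trivial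
  induction hv using Submodule.span_induction with
  | mem x hx =>
    obtain ⟨g, rfl⟩ := hx
    simpa [hPw] using hc g
  | zero => exact ⟨0, by simp⟩
  | add x y _ _ hx hy =>
    obtain ⟨a, ha⟩ := hx
    obtain ⟨b, hb⟩ := hy
    exact ⟨a + b, by rw [map_add, ha, hb, add_smul]⟩
  | smul c x _ hx =>
    obtain ⟨a, ha⟩ := hx
    exact ⟨c * a, by rw [map_smul, ha, mul_smul]⟩

lemma rho_eq_one_or_character_sub [CharP F 2]
    (hρ : ∀ S : Submodule ℂ V, (∀ g, ∀ v ∈ S, ρ g v ∈ S) → S = ⊥ ∨ S = ⊤) :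
    (∀ g, ρ g = 1) ∨ ρ.character 1 - ρ.character (unip 1) = Fintype.card F := by
  have hθ : AddChar.FiniteField.primitiveChar_to_Complex F ≠ 1 := by
    have := (AddChar.FiniteField.primitiveChar_to_Complex_isPrimitive F) one_ne_zero
    rwa [AddChar.mulShift_one] at this
  have hs : ∑ x, AddChar.FiniteField.primitiveChar_to_Complex F x = 0 :=
    AddChar.sum_eq_zero_iff_ne_zero.2 hθ
  have ht := trace_unipProj ρ (AddChar.FiniteField.primitiveChar_to_Complex F)
  rw [hs] at ht
  have hq := card_ne_zero (F := F)
  by_cases h0 : unipProj ρ (AddChar.FiniteField.primitiveChar_to_Complex F) = 0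
  · left
    rw [h0, map_zero, eq_comm, mul_eq_zero, or_iff_right (inv_ne_zero hq)] at ht
    have h1 : unipProj ρ 1 = 1 := by
      apply eq_one_of_trace_eq_finrank (isIdempotentElem_unipProj ρ 1)
      rw [trace_unipProj_one, ← Representation.char_one ρ]
      field_simp
      linear_combination (1 - Fintype.card F : ℂ) * ht
    refine rho_eq_one_of_unip ρ fun x => ?_
    have := rho_unip_mul_unipProj ρ 1 x
    rwa [h1, AddChar.one_apply, one_smul, mul_one] at this
  · right
    rw [trace_unipProj_eq_one ρ hρ hθ h0] at ht
    field_simp at ht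
    linear_combination -ht

lemma sum_character_borel [CharP F 2] [DecidableEq F]
    (h1 : ρ.character 1 = Fintype.card F) (h2 : ρ.character (unip 1) = 0) :
    ∑ p : Fˣ × F, ρ.character (diag p.1 * unip p.2) = (Fintype.card F - 1) * Fintype.card F := by
  have hq := card_ne_zero (F := F)
  obtain ⟨v, hv0, hv, hline⟩ := exists_of_trace_eq_one (isIdempotentElem_unipProj ρ 1)
    (by rw [trace_unipProj_one, h1, h2]; field_simp; simp)
  have hT : ∀ a : Fˣ, ρ (diag a) * unipProj ρ 1 = unipProj ρ 1 := fun a => by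
    ext x
    obtain ⟨c, hc⟩ := hline x
    rw [Module.End.mul_apply, hc, map_smul, diag_apply_of_unipProj ρ hv0 hv hline a]
  have hsum : ∑ x : F, ρ (unip x) = (Fintype.card F : ℂ) • unipProj ρ 1 := by
    rw [unipProj, smul_smul, mul_inv_cancel₀ hq]; simp
  rw [Fintype.sum_prod_type]
  have : ∀ a : Fˣ, ∑ x : F, ρ.character (diag a * unip x) = Fintype.card F := fun a => by
    simp only [Representation.character, map_mul]
    rw [← map_sum, ← Finset.mul_sum, hsum, mul_smul_comm, hT, map_smul, trace_unipProj_one, h1, h2]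
    simp [hq]
  simp only [this, Finset.sum_const, Finset.card_univ, Fintype.card_units, nsmul_eq_mul]
  rw [Nat.cast_sub Fintype.card_pos, Nat.cast_one]
end Rep

lemma character_of_trace_eq_zero [Finite F] [CharP F 2] {V : Type*} [AddCommGroup V] [Module ℂ V]
    (ρ : Representation ℂ (SpecialLinearGroup (Fin 2) F) V) (g : SpecialLinearGroup (Fin 2) F)
    (hg : g 0 0 = g 1 1) (h1 : g ≠ 1) : ρ.character g = ρ.character (unip 1) := by
  have := Fintype.ofFinite F
  have key : ∀ g : SpecialLinearGroup (Fin 2) F, g 1 0 = 0 → g 0 0 = g 1 1 → g ≠ 1 →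
      ρ.character g = ρ.character (unip 1) := by
    intro g h10 hg h1
    have hd := det_entries g
    rw [h10, mul_zero, sub_zero, ← hg] at hd
    have h00 : g 0 0 = 1 := by
      have : (g 0 0 + 1) ^ 2 = 0 := by
        rw [CharTwo.add_sq, sq, hd, one_pow, CharTwo.add_self_eq_zero]
      rw [pow_eq_zero_iff two_ne_zero, CharTwo.add_eq_zero] at this
      exact this
    have hgu : g = unip (g 0 1) := by
      apply ext_entries <;> simp [h00, h10, ← hg]
    rw [hgu]
    refine character_unip ρ fun h0 => h1 ?_
    rw [hgu, h0, unip_zero]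
  by_cases h10 : g 1 0 = 0
  · exact key g h10 hg h1
  · obtain ⟨x, hx⟩ := FiniteField.isSquare_of_char_two (ringChar.eq F 2) (g 0 1 / g 1 0)
    have hb : g 0 1 = g 1 0 * (x * x) := by rw [← hx]; field_simp
    have hc : ρ.character g = ρ.character ((unip x * weyl)⁻¹ * g * (unip x * weyl)) := by
      conv_rhs => rw [← Representation.char_conj ρ _ (unip x * weyl)]
      congr 1; group
    rw [hc]
    apply key
    · simp [mul_entry, hb, hg]; ring
    · simp [mul_entry, hg]
      linear_combination (x * g 1 0) * (CharTwo.two_eq_zero (R := F))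
    · intro h
      apply h1
      have : g = (unip x * weyl) * ((unip x * weyl)⁻¹ * g * (unip x * weyl)) *
        (unip x * weyl)⁻¹ := by group
      rw [this, h]; group

section Count

variable [Fintype F] [Fintype (SpecialLinearGroup (Fin 2) F)] [DecidableEq F]

lemma sum_borel {M : Type*} [AddCommMonoid M] (f : SpecialLinearGroup (Fin 2) F → M) :
    ∑ g, (if g 1 0 = 0 then f g else 0) = ∑ p : Fˣ × F, f (diag p.1 * unip p.2) := by
  rw [← Finset.sum_filter]
  symm
  refine Finset.sum_nbij (fun p : Fˣ × F => diag p.1 * unip p.2) ?_ ?_ ?_ fun _ _ => rfl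
  · intro p _
    simp [mul_entry]
  · rintro ⟨a, x⟩ _ ⟨b, y⟩ _ h
    have h0 : (diag a * unip x) 0 0 = (diag b * unip y) 0 0 := by
      simp only at h; rw [h]
    have h1 : (diag a * unip x) 0 1 = (diag b * unip y) 0 1 := by
      simp only at h; rw [h]
    simp only [mul_entry, diag_00, unip_00, mul_one, diag_01, zero_mul, add_zero, unip_01,
      Units.val_inj] at h0 h1
    subst h0
    simpa using h1
  · intro g hg
    obtain ⟨a, x, rfl⟩ := eq_diag_mul_unip g (by simpa using hg)
    exact ⟨(a, x), by simp, rfl⟩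

lemma sum_bigCell {M : Type*} [AddCommMonoid M] (f : SpecialLinearGroup (Fin 2) F → M) :
    ∑ g, (if g 1 0 = 0 then 0 else f g) =
      ∑ p : F × Fˣ × F, f (unip p.1 * (weyl * diag p.2.1) * unip p.2.2) := by
  simp_rw [← ite_not (_ = _)]
  rw [← Finset.sum_filter]
  symm
  refine Finset.sum_nbij (fun p : F × Fˣ × F => unip p.1 * (weyl * diag p.2.1) * unip p.2.2)
    ?_ ?_ ?_ fun _ _ => rfl
  · intro p _
    simp [mul_entry]
  · rintro ⟨x, a, y⟩ _ ⟨x', a', y'⟩ _ h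
    simp only at h
    have e : ∀ i j : Fin 2,
        (unip x * (weyl * diag a) * unip y : SpecialLinearGroup (Fin 2) F) i j =
        (unip x' * (weyl * diag a') * unip y' : SpecialLinearGroup (Fin 2) F) i j := fun i j => by rw [h]
    have h0 := e 0 0
    have h1 := e 1 0
    have h2 := e 1 1
    simp [mul_entry] at h0 h1 h2
    obtain rfl := Units.val_injective h1
    simp at h0 h2
    simp [h0, h2]
  · intro g hg
    have hg' : g 1 0 ≠ 0 := by simpa using hg
    exact ⟨(_, _, _), by simp, (eq_bruhat g hg').symm⟩

lemma card_SL2 : (Fintype.card (SpecialLinearGroup (Fin 2) F) : ℂ) =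
    Fintype.card F * ((Fintype.card F : ℂ) ^ 2 - 1) := by
  have h : ∑ g : SpecialLinearGroup (Fin 2) F, (1 : ℂ) =
      ∑ g : SpecialLinearGroup (Fin 2) F, (if g 1 0 = 0 then 1 else 0) +
      ∑ g : SpecialLinearGroup (Fin 2) F, (if g 1 0 = 0 then 0 else 1) := by
    rw [← Finset.sum_add_distrib]
    exact Finset.sum_congr rfl fun g _ => by split_ifs <;> simp
  rw [sum_borel (fun _ => (1 : ℂ)), sum_bigCell (fun _ => (1 : ℂ))] at h
  simp only [Finset.sum_const, Finset.card_univ, nsmul_eq_mul, mul_one, Fintype.card_prod,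
    Fintype.card_units, Nat.cast_mul] at h
  rw [h, Nat.cast_sub Fintype.card_pos, Nat.cast_one]
  ring

lemma card_trace_eq_zero [CharP F 2] :
    ∑ g : SpecialLinearGroup (Fin 2) F, (if g 0 0 = g 1 1 then (1 : ℂ) else 0) =
      (Fintype.card F : ℂ) ^ 2 := by
  rw [← Finset.sum_filter, Finset.sum_const, nsmul_eq_mul, mul_one,
    ← Nat.cast_pow, Nat.cast_inj, sq, ← Fintype.card_prod, ← Finset.card_univ]
  refine Finset.card_nbij (fun g => (g 0 1, g 1 0)) (fun _ _ => by simp) ?_ ?_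
  · intro g hg h hh e
    simp only [Finset.coe_filter, Finset.mem_univ, true_and, Set.mem_ofPred_eq] at hg hh
    simp only [Prod.mk.injEq] at e
    have h1 := det_entries g
    have h2 := det_entries h
    rw [← hg] at h1
    rw [← hh] at h2
    have h3 : g 0 0 = h 0 0 := by
      have : (g 0 0 + h 0 0) ^ 2 = 0 := by
        rw [CharTwo.add_sq, ← CharTwo.sub_eq_add]
        rw [e.1, e.2] at h1
        linear_combination h1 - h2
      rw [pow_eq_zero_iff two_ne_zero, CharTwo.add_eq_zero] at this
      exact this
    exact ext_entries h3 e.1 e.2 (by rw [← hg, ← hh, h3])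
  · rintro ⟨b, c⟩ _
    obtain ⟨a, ha⟩ := FiniteField.isSquare_of_char_two (ringChar.eq F 2) (1 + b * c)
    exact ⟨⟨!![a, b; c, a], by rw [det_fin_two_of]; linear_combination -ha⟩,
      Finset.mem_coe.2 (Finset.mem_filter.2 ⟨Finset.mem_univ _, rfl⟩), rfl⟩

lemma sum_character_trace_eq_zero [CharP F 2] {V : Type*} [AddCommGroup V] [Module ℂ V]
    (ρ : Representation ℂ (SpecialLinearGroup (Fin 2) F) V) :
    ∑ g : SpecialLinearGroup (Fin 2) F, (if g 0 0 = g 1 1 then ρ.character g else 0) =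
      ρ.character 1 + ((Fintype.card F : ℂ) ^ 2 - 1) * ρ.character (unip 1) := by
  have h : ∀ g : SpecialLinearGroup (Fin 2) F, (if g 0 0 = g 1 1 then ρ.character g else 0) =
      (if g = 1 then ρ.character 1 - ρ.character (unip 1) else 0) +
      (if g 0 0 = g 1 1 then 1 else 0) * ρ.character (unip 1) := by
    intro g
    by_cases h1 : g = 1
    · simp [h1]
    · by_cases h2 : g 0 0 = g 1 1
      · simp [h1, h2, character_of_trace_eq_zero ρ g h2 h1]
      · simp [h1, h2]
  simp_rw [h]
  rw [Finset.sum_add_distrib, ← Finset.sum_mul, card_trace_eq_zero, Finset.sum_ite_eq']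
  simp
  ring

end Count

/-- The Steinberg character: the number of fixed points on the projective line, minus one. -/
def steinberg [Fintype F] [DecidableEq F] (g : SpecialLinearGroup (Fin 2) F) : ℤ :=
  ∑ x : F, (if g 1 0 * x ^ 2 + (g 1 1 - g 0 0) * x - g 0 1 = 0 then 1 else 0) +
    (if g 1 0 = 0 then 1 else 0) - 1

lemma steinberg_sq [Fintype F] [DecidableEq F] [CharP F 2]
    [DecidableEq (SpecialLinearGroup (Fin 2) F)] (g : SpecialLinearGroup (Fin 2) F) :
    steinberg g ^ 2 = 1 + (Fintype.card F : ℤ) ^ 2 * (if g = 1 then 1 else 0) -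
      (if g 0 0 = g 1 1 then 1 else 0) := by
  by_cases h1 : g = 1
  · subst h1
    simp [steinberg]
  have hd := det_entries g
  by_cases h10 : g 1 0 = 0
  · by_cases htr : g 0 0 = g 1 1
    · have h00 : g 0 0 = 1 := by
        rw [h10, mul_zero, sub_zero, ← htr] at hd
        have : (g 0 0 + 1) ^ 2 = 0 := by
          rw [CharTwo.add_sq, sq, hd, one_pow, CharTwo.add_self_eq_zero]
        rw [pow_eq_zero_iff two_ne_zero, CharTwo.add_eq_zero] at this
        exact this
      have h01 : g 0 1 ≠ 0 := fun h01 => h1 (by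
        apply ext_entries <;> simp [h00, h01, h10, ← htr])
      simp [steinberg, h1, h10, htr, h01]
    · have : ∀ x, g 1 0 * x ^ 2 + (g 1 1 - g 0 0) * x - g 0 1 = 0 ↔
          x = g 0 1 / (g 1 1 - g 0 0) := fun x => by
        rw [h10, eq_div_iff (sub_ne_zero.2 (Ne.symm htr)), zero_mul, zero_add, sub_eq_zero,
          mul_comm]
      simp only [steinberg, this]
      simp [h1, h10, htr]
  · by_cases htr : g 0 0 = g 1 1
    · obtain ⟨y, hy⟩ := FiniteField.isSquare_of_char_two (ringChar.eq F 2) (g 0 1 / g 1 0)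
      have : ∀ x, g 1 0 * x ^ 2 + (g 1 1 - g 0 0) * x - g 0 1 = 0 ↔ x = y := fun x => by
        have e : g 1 0 * x ^ 2 + (g 1 1 - g 0 0) * x - g 0 1 = g 1 0 * (x + y) ^ 2 := by
          rw [CharTwo.add_sq, htr, sub_self, zero_mul, add_zero, CharTwo.sub_eq_add, sq y, ← hy]
          field_simp
        rw [e, mul_eq_zero, or_iff_right h10, pow_eq_zero_iff two_ne_zero, CharTwo.add_eq_zero]
      simp only [steinberg, this]
      simp [h1, h10, htr]
    · by_cases hex : ∃ y, g 1 0 * y ^ 2 + (g 1 1 - g 0 0) * y - g 0 1 = 0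
      · obtain ⟨y, hy⟩ := hex
        have hne : y ≠ -((g 1 1 - g 0 0) / g 1 0) - y := fun h => by
          rw [eq_sub_iff_add_eq, CharTwo.add_self_eq_zero, eq_comm, neg_eq_zero,
            div_eq_zero_iff, or_iff_left h10, sub_eq_zero] at h
          exact htr h.symm
        have : ∀ x, g 1 0 * x ^ 2 + (g 1 1 - g 0 0) * x - g 0 1 = 0 ↔
            x ∈ ({y, -((g 1 1 - g 0 0) / g 1 0) - y} : Finset F) := fun x => by
          have e : g 1 0 * x ^ 2 + (g 1 1 - g 0 0) * x - g 0 1 =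
              g 1 0 * ((x - y) * (x - (-((g 1 1 - g 0 0) / g 1 0) - y))) := by
            rw [← sub_zero (_ - g 0 1), ← hy]
            field_simp
            ring
          rw [e, mul_eq_zero, or_iff_right h10, mul_eq_zero, sub_eq_zero, sub_eq_zero,
            Finset.mem_insert, Finset.mem_singleton]
        simp only [steinberg, this]
        rw [Finset.sum_ite_mem, Finset.univ_inter, Finset.sum_const, Finset.card_pair hne]
        simp [h1, h10, htr]
      · push Not at hex
        simp [steinberg, hex, h1, h10, htr]

/-- A representation whose only invariant subspaces are trivial has character sum zero, unless
the group acts trivially. -/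
lemma sum_character_eq_zero {G V : Type*} [Group G] [Fintype G] [AddCommGroup V] [Module ℂ V]
    [FiniteDimensional ℂ V] (ρ : Representation ℂ G V)
    (hρ : ∀ S : Submodule ℂ V, (∀ g, ∀ v ∈ S, ρ g v ∈ S) → S = ⊥ ∨ S = ⊤)
    (h : ¬ ∀ g, ρ g = 1) : ∑ g, ρ.character g = 0 := by
  have hbot : ρ.invariants = ⊥ := by
    refine (hρ ρ.invariants fun g v hv => ?_).resolve_right fun htop => h fun g => ?_
    · rwa [(Representation.mem_invariants _ _).1 hv g]
    · ext v
      have hv : v ∈ ρ.invariants := htop ▸ Submodule.mem_top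
      exact hv g
  have hc : (Nat.card G : ℂ) ≠ 0 := by simp
  have := invertibleOfNonzero hc
  have key := ρ.card_inv_mul_sum_char_eq_finrank
  rw [hbot, finrank_bot, Nat.cast_zero, mul_eq_zero] at key
  exact key.resolve_left (inv_ne_zero hc)

section Steinberg

variable [Fintype F] [Fintype (SpecialLinearGroup (Fin 2) F)] [DecidableEq F]

lemma sum_steinberg_mul {V : Type*} [AddCommGroup V] [Module ℂ V]
    (ρ : Representation ℂ (SpecialLinearGroup (Fin 2) F) V) :
    ∑ g, ((steinberg g : ℂ) + 1) * ρ.character g =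
      (Fintype.card F + 1) * ∑ p : Fˣ × F, ρ.character (diag p.1 * unip p.2) := by
  have hx : ∀ x : F, ∑ g : SpecialLinearGroup (Fin 2) F,
      (if g 1 0 * x ^ 2 + (g 1 1 - g 0 0) * x - g 0 1 = 0 then ρ.character g else 0) =
      ∑ g : SpecialLinearGroup (Fin 2) F, (if g 1 0 = 0 then ρ.character g else 0) := fun x => by
    refine Fintype.sum_equiv (MulAut.conj (unip x * weyl)⁻¹).toEquiv _ _ fun g => ?_
    simp only [MulEquiv.toEquiv_eq_coe, EquivLike.coe_coe, MulAut.conj_apply]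
    rw [Representation.char_conj]
    congr 1
    congr! 1
    simp [mul_entry]
    ring
  rw [← sum_borel, add_mul, one_mul]
  rw [← nsmul_eq_mul, ← Finset.card_univ, ← Finset.sum_const,
    Finset.sum_congr rfl fun x _ => (hx x).symm, Finset.sum_comm, ← Finset.sum_add_distrib]
  refine Finset.sum_congr rfl fun g _ => ?_
  simp only [steinberg]
  push_cast
  rw [sub_add_cancel, add_mul, Finset.sum_mul]
  simp only [ite_mul, one_mul, zero_mul]

/-- The only irreducible character of degree `q` is the Steinberg character. -/
lemma character_eq_steinberg [CharP F 2] (hF : Fintype.card F ≠ 1)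
    (V : FDRep ℂ (SpecialLinearGroup (Fin 2) F)) [CategoryTheory.Simple V]
    (hdeg : V.character 1 = Fintype.card F) (g : SpecialLinearGroup (Fin 2) F) :
    V.character g = steinberg g := by
  classical
  let ρ : Representation ℂ (SpecialLinearGroup (Fin 2) F) V := V.ρ
  have hV : ∀ g, V.character g = ρ.character g := fun _ => rfl
  have hq := card_ne_zero (F := F)
  have hinv : ∀ g, V.character g⁻¹ = starRingEnd ℂ (V.character g) :=
    Representation.character_inv_eq_conj ρ
  have hnorm := (FDRep.simple_iff_char_is_norm_one V).1 inferInstance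
  rw [Nat.card_eq_fintype_card] at hnorm
  have hsub : V.character (unip 1) = 0 := by
    rcases rho_eq_one_or_character_sub ρ (FDRep.eq_bot_or_eq_top_of_simple V) with h | h
    · have hc : ∀ g, V.character g = Fintype.card F := fun g => by
        rw [← hdeg, hV, hV, Representation.character, Representation.character, h, h]
      simp only [hc, Finset.sum_const, Finset.card_univ, nsmul_eq_mul] at hnorm
      have hG : (Fintype.card (SpecialLinearGroup (Fin 2) F) : ℂ) ≠ 0 := by simp
      rw [mul_eq_left₀ hG] at hnorm
      exact absurd (Nat.eq_one_of_mul_eq_one_right (by exact_mod_cast hnorm)) hF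
    · rw [← hV, ← hV, hdeg] at h
      linear_combination -h
  have hcross : ∑ g, (steinberg g : ℂ) * V.character g =
      Fintype.card (SpecialLinearGroup (Fin 2) F) := by
    have h0 : ∑ g, V.character g = 0 := by
      refine sum_character_eq_zero ρ (FDRep.eq_bot_or_eq_top_of_simple V) fun h => ?_
      have : V.character (unip 1) = V.character 1 := by
        rw [hV, hV, Representation.character, Representation.character, h, h]
      rw [hsub, hdeg] at this
      exact hq this.symm
    have h1 := sum_steinberg_mul ρ
    rw [sum_character_borel ρ hdeg hsub] at h1
    simp only [add_mul, one_mul, Finset.sum_add_distrib] at h1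
    have h0' : ∑ g, ρ.character g = 0 := h0
    rw [h0', add_zero] at h1
    change ∑ g, (steinberg g : ℂ) * ρ.character g = _
    rw [h1, card_SL2]
    ring
  have hst : ∑ g : SpecialLinearGroup (Fin 2) F, (steinberg g : ℂ) ^ 2 =
      Fintype.card (SpecialLinearGroup (Fin 2) F) := by
    have h : ∀ g : SpecialLinearGroup (Fin 2) F, (steinberg g : ℂ) ^ 2 =
        1 + (Fintype.card F : ℂ) ^ 2 * (if g = 1 then 1 else 0) -
          (if g 0 0 = g 1 1 then 1 else 0) := fun g => by exact_mod_cast steinberg_sq g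
    simp only [h]
    rw [Finset.sum_sub_distrib, Finset.sum_add_distrib, card_trace_eq_zero, ← Finset.mul_sum,
      Finset.sum_ite_eq']
    simp
  have hcross' := congrArg (starRingEnd ℂ) hcross
  simp only [map_sum, map_mul, map_intCast, map_natCast] at hcross'
  simp only [hinv] at hnorm
  have hzero : ∑ g, Complex.normSq (V.character g - steinberg g) = 0 := by
    rw [← Complex.ofReal_eq_zero, Complex.ofReal_sum]
    have h : ∀ g, (Complex.normSq (V.character g - steinberg g) : ℂ) =
        V.character g * starRingEnd ℂ (V.character g) - steinberg g * V.character g -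
          steinberg g * starRingEnd ℂ (V.character g) + (steinberg g : ℂ) ^ 2 := fun g => by
      rw [← Complex.mul_conj, map_sub, map_intCast]
      ring
    simp only [h, Finset.sum_add_distrib, Finset.sum_sub_distrib, hnorm, hcross, hcross', hst]
    ring
  rw [Finset.sum_eq_zero_iff_of_nonneg fun g _ => Complex.normSq_nonneg _] at hzero
  exact sub_eq_zero.1 (Complex.normSq_eq_zero.1 (hzero g (Finset.mem_univ g)))

lemma sum_steinberg_sq_mul [CharP F 2] (V : FDRep ℂ (SpecialLinearGroup (Fin 2) F))
    [CategoryTheory.Simple V] :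
    ∑ g, (steinberg g : ℂ) ^ 2 * V.character g =
      Fintype.card (SpecialLinearGroup (Fin 2) F) := by
  classical
  let ρ : Representation ℂ (SpecialLinearGroup (Fin 2) F) V := V.ρ
  have hq := card_ne_zero (F := F)
  have h : ∀ g : SpecialLinearGroup (Fin 2) F, (steinberg g : ℂ) ^ 2 * V.character g =
      ρ.character g + (if g = 1 then (Fintype.card F : ℂ) ^ 2 * ρ.character 1 else 0) -
        (if g 0 0 = g 1 1 then ρ.character g else 0) := fun g => by
    have : (steinberg g : ℂ) ^ 2 =
        1 + (Fintype.card F : ℂ) ^ 2 * (if g = 1 then 1 else 0) -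
          (if g 0 0 = g 1 1 then 1 else 0) := by exact_mod_cast steinberg_sq g
    change _ * ρ.character g = _
    rw [this]
    by_cases h1 : g = 1
    · subst h1; simp
    · split_ifs <;> simp
  simp only [h]
  rw [Finset.sum_sub_distrib, Finset.sum_add_distrib, sum_character_trace_eq_zero,
    Finset.sum_ite_eq', if_pos (Finset.mem_univ _)]
  by_cases h1 : ∀ g, ρ g = 1
  · have hc : ∀ g, ρ.character g = 1 := by
      have hr : ∀ g, ρ.character g = Module.finrank ℂ V := fun g => by
        rw [Representation.character, h1, LinearMap.trace_one]
      have hnorm := (FDRep.simple_iff_char_is_norm_one V).1 inferInstance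
      change ∑ g, ρ.character g * ρ.character g⁻¹ = _ at hnorm
      simp only [hr, Finset.sum_const, Finset.card_univ, nsmul_eq_mul,
        Nat.card_eq_fintype_card] at hnorm
      have hG : (Fintype.card (SpecialLinearGroup (Fin 2) F) : ℂ) ≠ 0 := by simp
      rw [mul_eq_left₀ hG] at hnorm
      intro g
      have hsq : Module.finrank ℂ V * Module.finrank ℂ V = 1 := by exact_mod_cast hnorm
      rw [hr, Nat.eq_one_of_mul_eq_one_right hsq, Nat.cast_one]
    simp only [hc, Finset.sum_const, Finset.card_univ, nsmul_eq_mul]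
    ring
  · rw [sum_character_eq_zero ρ (FDRep.eq_bot_or_eq_top_of_simple V) h1, card_SL2]
    have h2 := (rho_eq_one_or_character_sub ρ
      (FDRep.eq_bot_or_eq_top_of_simple V)).resolve_left h1
    linear_combination ((Fintype.card F : ℂ) ^ 2 - 1) * h2

end Steinberg

end SL2

/-- For `q ≥ 8` a power of `2` and `G = SL₂(F_q)`, the square of the Steinberg character
(the irreducible character of degree `q`) contains every irreducible character exactly once. -/
theorem sl2_even_steinberg_square_covers
    (q : ℕ) (hq8 : 8 ≤ q) (hq : ∃ n : ℕ, 1 ≤ n ∧ q = 2 ^ n)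
    (F : Type) [Field F] [Fintype F] (hF : Fintype.card F = q)
    (χ ψ : Matrix.SpecialLinearGroup (Fin 2) F → ℂ)
    (hχ : IsIrreducibleCharacter _ χ) (hχdeg : χ 1 = (q : ℂ))
    (hψ : IsIrreducibleCharacter _ ψ) :
    charInner (fun g => χ g ^ 2) ψ = 1 := by
  classical
  obtain ⟨n, -, hn⟩ := hq
  have : Fact (Nat.Prime 2) := ⟨Nat.prime_two⟩
  have : CharP F 2 := charP_of_card_eq_prime_pow (hF.trans hn)
  obtain ⟨V, hV, rfl⟩ := hχ
  obtain ⟨W, hW, rfl⟩ := hψ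
  let : Fintype (Matrix.SpecialLinearGroup (Fin 2) F) := Fintype.ofFinite _
  have hst := SL2.character_eq_steinberg (F := F) (by omega) V (by rw [hχdeg, hF])
  have hW' := congrArg (starRingEnd ℂ) (SL2.sum_steinberg_sq_mul W)
  simp only [map_sum, map_mul, map_pow, map_intCast, map_natCast] at hW'
  simp only [charInner, hst]
  rw [hW']
  exact inv_mul_cancel₀ (by simp)
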